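/- For the unit disk with constant refractive index n > 0 and conductivity η > 0, k > 0 is a transmission eigenvalue with conductive boundary condition if and only if for some integer m ≥ 0 the 2×2 determinant det [[J_m(k√n), −J_m(k)], [k√n J_m'(k√n) − η J_m(k√n), −k J_m'(k)]] vanishes, i.e., −k J_m'(k) J_m(k√n) + J_m(k)(k√n J_m'(k√n) − η J_m(k√n)) = 0. -/

import Mathlib

open MeasureTheory Filter Topology
open scoped RealInnerProductSpace

noncomputable section

/-- Componentwise Laplacian via iterated Fréchet derivatives. -/
noncomputable def lap {d : ℕ} {F : Type*} [NormedAddCommGroup F] [NormedSpace ℝ F]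
    (u : EuclideanSpace ℝ (Fin d) → F) (x : EuclideanSpace ℝ (Fin d)) : F :=
  ∑ i, fderiv ℝ (fun y => fderiv ℝ u y (EuclideanSpace.single i 1)) x (EuclideanSpace.single i 1)

/-- Partial derivative in direction `i`. -/
noncomputable def pd {d : ℕ} {F : Type*} [NormedAddCommGroup F] [NormedSpace ℝ F]
    (i : Fin d) (u : EuclideanSpace ℝ (Fin d) → F) (x : EuclideanSpace ℝ (Fin d)) : F :=
  fderiv ℝ u x (EuclideanSpace.single i 1)

/-- Normal derivative with respect to the (outward unit normal) field `ν`. -/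
noncomputable def nder {d : ℕ} {F : Type*} [NormedAddCommGroup F] [NormedSpace ℝ F]
    (ν : EuclideanSpace ℝ (Fin d) → EuclideanSpace ℝ (Fin d))
    (u : EuclideanSpace ℝ (Fin d) → F) (x : EuclideanSpace ℝ (Fin d)) : F :=
  ∑ i, ν x i • pd i u x

/-- Stand-in for `X(D) = H²(D) ∩ H¹₀(D)`: twice differentiable functions vanishing on `∂D`. -/
def XD {d : ℕ} (D : Set (EuclideanSpace ℝ (Fin d))) (F : Type*) [NormedAddCommGroup F]
    [NormedSpace ℝ F] : Set (EuclideanSpace ℝ (Fin d) → F) :=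
  {φ | ContDiff ℝ 2 φ ∧ ∀ x ∈ frontier D, φ x = 0}
/-- The Bessel function of the first kind of integer order `m`, via its power series. -/
noncomputable def besselJ (m : ℕ) (x : ℝ) : ℝ :=
  ∑' j : ℕ, ((-1 : ℝ) ^ j / (j.factorial * (j + m).factorial)) * (x / 2) ^ (2 * j + m)

/-- The coefficients of the entire function underlying `besselJ`. -/
def bC (m j : ℕ) : ℝ := (-1 : ℝ) ^ j / (j.factorial * (j + m).factorial)

/-- The entire function `G_m` with `J_m(x) = (x/2)^m G_m(x^2/4)`. -/
def bG (m : ℕ) (t : ℝ) : ℝ := ∑' j : ℕ, bC m j * t ^ j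

lemma bC_abs_le (m j : ℕ) : |bC m j| ≤ 1 / (j.factorial : ℝ) := by
  unfold bC
  rw [abs_div, abs_pow, abs_neg, abs_one, one_pow, abs_of_pos (by positivity)]
  apply one_div_le_one_div_of_le (by positivity)
  have h1 : (1 : ℝ) ≤ ((j + m).factorial : ℝ) := by exact_mod_cast Nat.factorial_pos _
  have h2 : (0 : ℝ) < (j.factorial : ℝ) := by positivity
  nlinarith

lemma bG_summable (m : ℕ) (t : ℝ) : Summable (fun j : ℕ => bC m j * t ^ j) := by
  refine Summable.of_norm_bounded (g := fun j => |t| ^ j / (j.factorial : ℝ))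
    (Real.summable_pow_div_factorial |t|) ?_
  intro j
  rw [norm_mul, norm_pow, Real.norm_eq_abs, Real.norm_eq_abs]
  have := mul_le_mul_of_nonneg_right (bC_abs_le m j) (pow_nonneg (abs_nonneg t) j)
  calc _ ≤ _ := this
    _ = _ := by ring

lemma bC_succ (m j : ℕ) : bC m (j + 1) * ((j : ℝ) + 1) = - bC (m + 1) j := by
  unfold bC
  have h : j + 1 + m = j + (m + 1) := by ring
  rw [h, Nat.factorial_succ]
  push_cast
  field_simp
  ring

lemma bG_hasDerivAt (m : ℕ) (t : ℝ) : HasDerivAt (bG m) (- bG (m + 1) t) t := by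
  have hs : Summable (fun j : ℕ => (j : ℝ) * ((|t| + 1) ^ (j - 1) / (j.factorial : ℝ))) := by
    rw [← summable_nat_add_iff 1]
    refine (Real.summable_pow_div_factorial (|t| + 1)).congr ?_
    intro j
    rw [Nat.factorial_succ]
    push_cast
    field_simp
  have key := hasDerivAt_tsum_of_isPreconnected (𝕜 := ℝ) (F := ℝ)
    (g := fun j y => bC m j * y ^ j)
    (g' := fun j y => bC m j * ((j : ℝ) * y ^ (j - 1)))
    (t := Metric.ball (0 : ℝ) (|t| + 1)) (y₀ := t) (y := t) hs Metric.isOpen_ball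
    (convex_ball (0 : ℝ) _).isPreconnected
    (fun j y _ => (hasDerivAt_pow j y).const_mul _) ?_ (by simp) (bG_summable m t) (by simp)
  · have h2 : ∑' j : ℕ, bC m j * ((j : ℝ) * t ^ (j - 1)) = - bG (m + 1) t := by
      have hsum : Summable (fun j : ℕ => bC m j * ((j : ℝ) * t ^ (j - 1))) := by
        rw [← summable_nat_add_iff 1]
        refine (bG_summable (m + 1) t).neg.congr ?_
        intro j
        have := bC_succ m j
        simp only [Nat.add_sub_cancel]
        push_cast
        linear_combination (-t ^ j) * this
      rw [hsum.tsum_eq_zero_add]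
      simp only [Nat.cast_zero, zero_mul, mul_zero, zero_add, bG]
      rw [← tsum_neg]
      congr 1
      ext j
      have := bC_succ m j
      simp only [Nat.add_sub_cancel]
      push_cast
      linear_combination (t ^ j) * this
    rw [h2] at key
    exact key
  · intro j y hy
    have hy' : |y| ≤ |t| + 1 := by
      have := mem_ball_zero_iff.1 hy
      rw [Real.norm_eq_abs] at this
      exact this.le
    rw [norm_mul, norm_mul, norm_pow, Real.norm_eq_abs, Real.norm_eq_abs, Real.norm_eq_abs,
      Nat.abs_cast]
    calc |bC m j| * ((j : ℝ) * |y| ^ (j - 1))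
        ≤ 1 / (j.factorial : ℝ) * ((j : ℝ) * (|t| + 1) ^ (j - 1)) := by
          gcongr
          exact bC_abs_le m j
      _ = _ := by ring

lemma bG_ode (m : ℕ) (t : ℝ) :
    t * bG (m + 2) t - ((m : ℝ) + 1) * bG (m + 1) t + bG m t = 0 := by
  have h0 := bG_summable m t
  have h1 := bG_summable (m + 1) t
  have h2 := bG_summable (m + 2) t
  have hA : Summable (fun j : ℕ => bC m j * t ^ j - ((m : ℝ) + 1) * (bC (m + 1) j * t ^ j)) :=
    h0.sub (h1.mul_left _)
  have hB : bG m t - ((m : ℝ) + 1) * bG (m + 1) t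
      = ∑' j : ℕ, (bC m j * t ^ j - ((m : ℝ) + 1) * (bC (m + 1) j * t ^ j)) := by
    rw [h0.tsum_sub (h1.mul_left _), tsum_mul_left]
    rfl
  have hC : t * bG (m + 2) t = ∑' j : ℕ, t * (bC (m + 2) j * t ^ j) := by
    rw [tsum_mul_left]; rfl
  rw [hA.tsum_eq_zero_add] at hB
  have hz : bC m 0 * t ^ 0 - ((m : ℝ) + 1) * (bC (m + 1) 0 * t ^ 0) = 0 := by
    unfold bC
    simp only [zero_add, Nat.factorial_succ, Nat.factorial_zero]
    push_cast
    field_simp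
    ring
  have hj : ∀ j : ℕ, bC m (j + 1) * t ^ (j + 1) - ((m : ℝ) + 1) * (bC (m + 1) (j + 1) * t ^ (j + 1))
      = - (t * (bC (m + 2) j * t ^ j)) := by
    intro j
    have : bC m (j + 1) - ((m : ℝ) + 1) * bC (m + 1) (j + 1) = - bC (m + 2) j := by
      unfold bC
      have e1 : j + 1 + (m + 1) = (j + m + 1) + 1 := by ring
      have e2 : j + (m + 2) = (j + m + 1) + 1 := by ring
      have e3 : j + 1 + m = j + m + 1 := by ring
      rw [e1, e2, e3, Nat.factorial_succ (j + m + 1), Nat.factorial_succ j]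
      push_cast
      field_simp
      ring
    linear_combination t ^ (j + 1) * this
  simp_rw [hj] at hB
  rw [hz, tsum_neg, ← hC] at hB
  linarith

lemma bG_zero (m : ℕ) : bG m 0 ≠ 0 := by
  unfold bG
  rw [tsum_eq_single 0 (by intro j hj; simp [hj])]
  simp [bC]
  positivity

lemma bG_continuous (m : ℕ) : Continuous (bG m) :=
  continuous_iff_continuousAt.2 fun t => (bG_hasDerivAt m t).continuousAt

lemma bG_contDiff_nat (k : ℕ) : ∀ m : ℕ, ContDiff ℝ k (bG m) := by
  induction k with
  | zero => intro m; exact_mod_cast contDiff_zero.2 (bG_continuous m)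
  | succ k ih =>
    intro m
    push_cast
    rw [contDiff_succ_iff_deriv]
    refine ⟨fun t => (bG_hasDerivAt m t).differentiableAt, by simp, ?_⟩
    have : deriv (bG m) = fun t => - bG (m + 1) t := funext fun t => (bG_hasDerivAt m t).deriv
    rw [this]
    exact (ih (m + 1)).neg

lemma besselJ_eq (m : ℕ) (x : ℝ) : besselJ m x = (x / 2) ^ m * bG m (x ^ 2 / 4) := by
  unfold besselJ bG
  rw [← tsum_mul_left]
  congr 1
  ext j
  have : x ^ 2 / 4 = (x / 2) ^ 2 := by ring
  rw [this, ← pow_mul, pow_add]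
  unfold bC
  ring

/-- Explicit form of x times the derivative of J_m. -/
def bD (m : ℕ) (x : ℝ) : ℝ :=
  (x / 2) ^ m * (m * bG m (x ^ 2 / 4) - x ^ 2 / 2 * bG (m + 1) (x ^ 2 / 4))

lemma besselJ_deriv_exists (m : ℕ) (x : ℝ) :
    ∃ d, HasDerivAt (besselJ m) d x ∧ x * d = bD m x := by
  have h1 : HasDerivAt (fun y : ℝ => (y / 2) ^ m) (m * (x / 2) ^ (m - 1) * (1 / 2)) x :=
    ((hasDerivAt_id x).div_const 2).pow m
  have h2 : HasDerivAt (fun y : ℝ => y ^ 2 / 4) (x / 2) x := by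
    refine ((hasDerivAt_pow 2 x).div_const 4).congr_deriv ?_
    push_cast; ring
  have h3 := h1.mul ((bG_hasDerivAt m (x ^ 2 / 4)).comp x h2)
  refine ⟨_, h3.congr_of_eventuallyEq (Eventually.of_forall fun y => besselJ_eq m y), ?_⟩
  unfold bD
  have : (m : ℝ) * (x / 2) ^ m = (m : ℝ) * ((x / 2) ^ (m - 1) * (x / 2)) := by
    cases m with
    | zero => simp
    | succ k => simp [pow_succ]
  simp only [Function.comp]
  linear_combination (-bG m (x ^ 2 / 4)) * this

lemma besselJ_hasDerivAt (m : ℕ) (x : ℝ) : HasDerivAt (besselJ m) (deriv (besselJ m) x) x := by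
  obtain ⟨d, hd, -⟩ := besselJ_deriv_exists m x
  exact hd.differentiableAt.hasDerivAt

lemma bD_eq (m : ℕ) (x : ℝ) : x * deriv (besselJ m) x = bD m x := by
  obtain ⟨d, hd, h⟩ := besselJ_deriv_exists m x
  rw [hd.deriv, h]

lemma bD_continuous (m : ℕ) : Continuous (bD m) := by
  unfold bD
  have h1 : Continuous fun x : ℝ => bG m (x ^ 2 / 4) := (bG_continuous m).comp (by fun_prop)
  have h2 : Continuous fun x : ℝ => bG (m + 1) (x ^ 2 / 4) :=
    (bG_continuous (m + 1)).comp (by fun_prop)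
  fun_prop

lemma besselJ_continuous (m : ℕ) : Continuous (besselJ m) :=
  continuous_iff_continuousAt.2 fun t => (besselJ_hasDerivAt m t).continuousAt

lemma bD_deriv_exists (m : ℕ) (x : ℝ) :
    ∃ d, HasDerivAt (bD m) d x ∧ x * d = ((m : ℝ) ^ 2 - x ^ 2) * besselJ m x := by
  have h1 : HasDerivAt (fun y : ℝ => (y / 2) ^ m) (m * (x / 2) ^ (m - 1) * (1 / 2)) x :=
    ((hasDerivAt_id x).div_const 2).pow m
  have h2 : HasDerivAt (fun y : ℝ => y ^ 2 / 4) (x / 2) x := by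
    refine ((hasDerivAt_pow 2 x).div_const 4).congr_deriv ?_
    push_cast; ring
  have h2' : HasDerivAt (fun y : ℝ => y ^ 2 / 2) x x := by
    refine ((hasDerivAt_pow 2 x).div_const 2).congr_deriv ?_
    push_cast; ring
  have h3 := (bG_hasDerivAt m (x ^ 2 / 4)).comp x h2
  have h4 := (bG_hasDerivAt (m + 1) (x ^ 2 / 4)).comp x h2
  have h5 := h1.mul ((h3.const_mul (m : ℝ)).sub (h2'.mul h4))
  refine ⟨_, h5, ?_⟩
  rw [besselJ_eq]
  have : (m : ℝ) * (x / 2) ^ m = (m : ℝ) * ((x / 2) ^ (m - 1) * (x / 2)) := by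
    cases m with
    | zero => simp
    | succ k => simp [pow_succ]
  have ode := bG_ode m (x ^ 2 / 4)
  simp only [Function.comp, Pi.mul_apply, Pi.sub_apply]
  linear_combination (-(m * bG m (x ^ 2 / 4) - x ^ 2 / 2 * bG (m + 1) (x ^ 2 / 4))) * this
    + (x / 2) ^ m * x ^ 2 * ode

lemma besselJ_exp (m : ℕ) (κ s : ℝ) :
    HasDerivAt (fun s => besselJ m (κ * Real.exp s)) (bD m (κ * Real.exp s)) s := by
  have h : HasDerivAt (fun s => κ * Real.exp s) (κ * Real.exp s) s :=
    (Real.hasDerivAt_exp s).const_mul κ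
  refine ((besselJ_hasDerivAt m _).comp s h).congr_deriv ?_
  rw [← bD_eq]; ring

lemma bD_exp (m : ℕ) (κ s : ℝ) :
    HasDerivAt (fun s => bD m (κ * Real.exp s))
      (((m : ℝ) ^ 2 - (κ * Real.exp s) ^ 2) * besselJ m (κ * Real.exp s)) s := by
  have h : HasDerivAt (fun s => κ * Real.exp s) (κ * Real.exp s) s :=
    (Real.hasDerivAt_exp s).const_mul κ
  obtain ⟨d, hd, e⟩ := bD_deriv_exists m (κ * Real.exp s)
  refine (hd.comp s h).congr_deriv ?_
  rw [← e]; ring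

/-- Differentiation under the integral sign, continuous integrands. -/
lemma hasDerivAt_param {F F' : ℝ → ℝ → ℂ} (a b : ℝ) (hF : ∀ s, Continuous (F s))
    (hF' : Continuous (Function.uncurry F')) (hd : ∀ s θ, HasDerivAt (fun s => F s θ) (F' s θ) s)
    (s₀ : ℝ) :
    HasDerivAt (fun s => ∫ θ in a..b, F s θ) (∫ θ in a..b, F' s₀ θ) s₀ := by
  have hK : IsCompact (Set.Icc (s₀ - 1) (s₀ + 1) ×ˢ Set.uIcc a b) :=
    isCompact_Icc.prod isCompact_uIcc
  obtain ⟨C, hC⟩ := hK.exists_bound_of_continuousOn hF'.continuousOn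
  have hF's : Continuous (F' s₀) := hF'.comp (Continuous.prodMk_right s₀)
  refine (intervalIntegral.hasDerivAt_integral_of_dominated_loc_of_deriv_le
    (F := F) (F' := F') (bound := fun _ => C) (s := Set.Icc (s₀ - 1) (s₀ + 1))
    (Icc_mem_nhds (by linarith) (by linarith))
    (Eventually.of_forall fun s => (hF s).aestronglyMeasurable)
    ((hF s₀).intervalIntegrable a b) hF's.aestronglyMeasurable
    (Eventually.of_forall fun θ hθ s hs => hC (s, θ) ⟨hs, Set.uIoc_subset_uIcc hθ⟩)
    intervalIntegrable_const
    (Eventually.of_forall fun θ _ s _ => hd s θ)).2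

/-- Radial unit vector. -/
def ev (θ : ℝ) : EuclideanSpace ℝ (Fin 2) :=
  Real.cos θ • EuclideanSpace.single 0 1 + Real.sin θ • EuclideanSpace.single 1 1

/-- Angular unit vector. -/
def ew (θ : ℝ) : EuclideanSpace ℝ (Fin 2) :=
  (-Real.sin θ) • EuclideanSpace.single 0 1 + Real.cos θ • EuclideanSpace.single 1 1

lemma ev_hasDerivAt (θ : ℝ) : HasDerivAt ev (ew θ) θ :=
  ((Real.hasDerivAt_cos θ).smul_const _).add ((Real.hasDerivAt_sin θ).smul_const _)

lemma ew_hasDerivAt (θ : ℝ) : HasDerivAt ew (-ev θ) θ := by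
  refine (((Real.hasDerivAt_sin θ).neg.smul_const _).add
    ((Real.hasDerivAt_cos θ).smul_const _)).congr_deriv ?_
  unfold ev
  simp only [neg_smul, neg_add]

lemma ev_continuous : Continuous ev := by unfold ev; fun_prop
lemma ew_continuous : Continuous ew := by unfold ew; fun_prop

lemma ev_norm (θ : ℝ) : ‖ev θ‖ = 1 := by
  rw [EuclideanSpace.norm_eq]
  simp [ev, Fin.sum_univ_two]

lemma ev_periodic (θ : ℝ) : ev (θ + 2 * Real.pi) = ev θ := by simp [ev]
lemma ew_periodic (θ : ℝ) : ew (θ + 2 * Real.pi) = ew θ := by simp [ew]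

lemma exists_polar (x : EuclideanSpace ℝ (Fin 2)) (hx : x ≠ 0) :
    ∃ s θ : ℝ, x = Real.exp s • ev θ ∧ Real.exp s = ‖x‖ := by
  have hpos : 0 < ‖x‖ := norm_pos_iff.2 hx
  have hn : ‖(⟨x 0, x 1⟩ : ℂ)‖ = ‖x‖ := by
    rw [EuclideanSpace.norm_eq, Complex.norm_def, Complex.normSq_apply]
    simp [Fin.sum_univ_two, sq]
  refine ⟨Real.log ‖x‖, Complex.arg ⟨x 0, x 1⟩, ?_, Real.exp_log hpos⟩
  rw [Real.exp_log hpos]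
  have hre := Complex.norm_mul_cos_arg ⟨x 0, x 1⟩
  have him := Complex.norm_mul_sin_arg ⟨x 0, x 1⟩
  rw [hn] at hre him
  ext i
  fin_cases i
  · simpa [ev] using hre.symm
  · simpa [ev] using him.symm

section fwd
variable {u : EuclideanSpace ℝ (Fin 2) → ℂ}

lemma u_diff (hu : ContDiff ℝ 2 u) : Differentiable ℝ u := hu.differentiable (by norm_num)

lemma du_contDiff (hu : ContDiff ℝ 2 u) : ContDiff ℝ 1 (fderiv ℝ u) :=
  hu.fderiv_right (by norm_num)

lemma du_diff (hu : ContDiff ℝ 2 u) : Differentiable ℝ (fderiv ℝ u) :=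
  (du_contDiff hu).differentiable (by norm_num)

lemma d2u_cont (hu : ContDiff ℝ 2 u) : Continuous (fderiv ℝ (fderiv ℝ u)) :=
  (du_contDiff hu).continuous_fderiv (by norm_num)

lemma lap_eq (hu : ContDiff ℝ 2 u) (x : EuclideanSpace ℝ (Fin 2)) :
    lap u x = ∑ i : Fin 2, fderiv ℝ (fderiv ℝ u) x (EuclideanSpace.single i 1)
      (EuclideanSpace.single i 1) := by
  unfold lap
  refine Finset.sum_congr rfl fun i _ => ?_
  have := ((du_diff hu x).hasFDerivAt.clm_apply (hasFDerivAt_const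
    (EuclideanSpace.single i (1 : ℝ)) x)).fderiv
  rw [this]
  simp

lemma lap_continuous (hu : ContDiff ℝ 2 u) : Continuous (lap u) := by
  have : lap u = fun x => ∑ i : Fin 2, fderiv ℝ (fderiv ℝ u) x (EuclideanSpace.single i 1)
      (EuclideanSpace.single i 1) := funext (lap_eq hu)
  rw [this]
  have := d2u_cont hu
  fun_prop

lemma nder_eq (u : EuclideanSpace ℝ (Fin 2) → ℂ) (x : EuclideanSpace ℝ (Fin 2)) :
    nder id u x = fderiv ℝ u x x := by
  unfold nder pd
  have hx : x = x 0 • EuclideanSpace.single 0 1 + x 1 • EuclideanSpace.single 1 1 := by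
    ext i; fin_cases i <;> simp
  conv_rhs => rw [hx]; arg 1; rw [← hx]
  simp only [map_add, map_smul, Fin.sum_univ_two, id]

lemma d2_polar (hu : ContDiff ℝ 2 u) (x : EuclideanSpace ℝ (Fin 2)) (s θ : ℝ) :
    fderiv ℝ (fderiv ℝ u) x (Real.exp s • ev θ) (Real.exp s • ev θ)
    + fderiv ℝ (fderiv ℝ u) x (Real.exp s • ew θ) (Real.exp s • ew θ)
    = (Real.exp s : ℂ) ^ 2 * lap u x := by
  rw [lap_eq hu]
  unfold ev ew
  simp only [map_add, map_smul, Fin.sum_univ_two, add_apply,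
    smul_apply, Complex.real_smul]
  have : ((Real.sin θ : ℝ) : ℂ) ^ 2 + ((Real.cos θ : ℝ) : ℂ) ^ 2 = 1 := by
    exact_mod_cast Real.sin_sq_add_cos_sq θ
  push_cast at this ⊢
  generalize Complex.sin θ = S at *
  generalize Complex.cos θ = C at *
  linear_combination (Complex.exp s ^ 2 * (
    fderiv ℝ (fderiv ℝ u) x (EuclideanSpace.single 0 1) (EuclideanSpace.single 0 1) +
    fderiv ℝ (fderiv ℝ u) x (EuclideanSpace.single 1 1) (EuclideanSpace.single 1 1))) * this

lemma P_s (s θ : ℝ) : HasDerivAt (fun s => Real.exp s • ev θ) (Real.exp s • ev θ) s :=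
  (Real.hasDerivAt_exp s).smul_const _

lemma P_θ (s θ : ℝ) : HasDerivAt (fun θ => Real.exp s • ev θ) (Real.exp s • ew θ) θ :=
  (ev_hasDerivAt θ).const_smul (Real.exp s)

lemma Q_θ (s θ : ℝ) : HasDerivAt (fun θ => Real.exp s • ew θ) (-(Real.exp s • ev θ)) θ := by
  refine ((ew_hasDerivAt θ).const_smul (Real.exp s)).congr_deriv ?_
  simp

lemma U_s (hu : ContDiff ℝ 2 u) (s θ : ℝ) : HasDerivAt (fun s => u (Real.exp s • ev θ))
    (fderiv ℝ u (Real.exp s • ev θ) (Real.exp s • ev θ)) s :=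
  (u_diff hu _).hasFDerivAt.comp_hasDerivAt s (P_s s θ)

lemma U_ss (hu : ContDiff ℝ 2 u) (s θ : ℝ) :
    HasDerivAt (fun s => fderiv ℝ u (Real.exp s • ev θ) (Real.exp s • ev θ))
    (fderiv ℝ (fderiv ℝ u) (Real.exp s • ev θ) (Real.exp s • ev θ) (Real.exp s • ev θ)
      + fderiv ℝ u (Real.exp s • ev θ) (Real.exp s • ev θ)) s :=
  ((du_diff hu _).hasFDerivAt.comp_hasDerivAt s (P_s s θ)).clm_apply (P_s s θ)

lemma U_θ (hu : ContDiff ℝ 2 u) (s θ : ℝ) : HasDerivAt (fun θ => u (Real.exp s • ev θ))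
    (fderiv ℝ u (Real.exp s • ev θ) (Real.exp s • ew θ)) θ :=
  (u_diff hu _).hasFDerivAt.comp_hasDerivAt θ (P_θ s θ)

lemma U_θθ (hu : ContDiff ℝ 2 u) (s θ : ℝ) :
    HasDerivAt (fun θ => fderiv ℝ u (Real.exp s • ev θ) (Real.exp s • ew θ))
    (fderiv ℝ (fderiv ℝ u) (Real.exp s • ev θ) (Real.exp s • ew θ) (Real.exp s • ew θ)
      - fderiv ℝ u (Real.exp s • ev θ) (Real.exp s • ev θ)) θ := by
  refine (((du_diff hu _).hasFDerivAt.comp_hasDerivAt θ (P_θ s θ)).clm_apply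
    (Q_θ s θ)).congr_deriv ?_
  simp [sub_eq_add_neg]

/-- The character `e^{-imθ}`. -/
def chr (m : ℤ) (θ : ℝ) : ℂ := Complex.exp (-(m * Complex.I) * θ)

lemma chr_hasDerivAt (m : ℤ) (θ : ℝ) :
    HasDerivAt (chr m) (-(m * Complex.I) * chr m θ) θ := by
  have h1 : HasDerivAt (fun θ : ℝ => -(m * Complex.I) * (θ : ℂ)) (-(m * Complex.I)) θ := by
    simpa using (Complex.ofRealCLM.hasDerivAt (x := θ)).const_mul (-(m * Complex.I))
  refine h1.cexp.congr_deriv ?_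
  unfold chr; ring

lemma chr_continuous (m : ℤ) : Continuous (chr m) := by unfold chr; fun_prop

lemma chr_periodic (m : ℤ) (θ : ℝ) : chr m (θ + 2 * Real.pi) = chr m θ := by
  unfold chr
  have : -(m * Complex.I) * ((θ + 2 * Real.pi : ℝ) : ℂ)
      = -(m * Complex.I) * θ + ((-m : ℤ) : ℂ) * (2 * Real.pi * Complex.I) := by
    push_cast; ring
  rw [this, Complex.exp_add, Complex.exp_int_mul_two_pi_mul_I, mul_one]

/-- Integration by parts against a character for periodic functions. -/
lemma ibp (m : ℤ) {f f' : ℝ → ℂ} (hf : ∀ θ, HasDerivAt f (f' θ) θ) (hf' : Continuous f')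
    (hp : f (2 * Real.pi) = f 0) :
    ∫ θ in (0 : ℝ)..(2 * Real.pi), f' θ * chr m θ
      = (m * Complex.I) * ∫ θ in (0 : ℝ)..(2 * Real.pi), f θ * chr m θ := by
  have hfc : Continuous f := continuous_iff_continuousAt.2 fun θ => (hf θ).continuousAt
  have hca : Continuous fun θ => f' θ * chr m θ := hf'.mul (chr_continuous m)
  have hcb : Continuous fun θ => f θ * (-(m * Complex.I) * chr m θ) :=
    hfc.mul (continuous_const.mul (chr_continuous m))
  have h := intervalIntegral.integral_deriv_mul_eq_sub_of_hasDerivAt (a := 0) (b := 2 * Real.pi)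
    (u := f) (v := chr m) (u' := f') (v' := fun θ => -(m * Complex.I) * chr m θ)
    hfc.continuousOn (chr_continuous m).continuousOn
    (fun θ _ => hf θ) (fun θ _ => chr_hasDerivAt m θ)
    (hf'.intervalIntegrable _ _) ((continuous_const.mul (chr_continuous m)).intervalIntegrable _ _)
  have hc : chr m (2 * Real.pi) = chr m 0 := by simpa using chr_periodic m 0
  rw [hp, hc, sub_self, intervalIntegral.integral_add
    (hca.intervalIntegrable _ _) (hcb.intervalIntegrable _ _)] at h
  rw [← intervalIntegral.integral_const_mul]
  have h2 : ∫ θ in (0 : ℝ)..(2 * Real.pi), f θ * (-(m * Complex.I) * chr m θ)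
      = - ∫ θ in (0 : ℝ)..(2 * Real.pi), (m * Complex.I) * (f θ * chr m θ) := by
    rw [← intervalIntegral.integral_neg]
    congr 1; ext θ; ring
  rw [h2] at h
  linear_combination h

/-- Fourier coefficient on the circle of radius `r`. -/
def cR (u : EuclideanSpace ℝ (Fin 2) → ℂ) (m : ℤ) (r : ℝ) : ℂ :=
  ∫ θ in (0 : ℝ)..(2 * Real.pi), u (r • ev θ) * chr m θ

/-- Fourier coefficient of the radial derivative on the circle of radius `r`. -/
def dR (u : EuclideanSpace ℝ (Fin 2) → ℂ) (m : ℤ) (r : ℝ) : ℂ :=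
  ∫ θ in (0 : ℝ)..(2 * Real.pi), fderiv ℝ u (r • ev θ) (r • ev θ) * chr m θ

lemma cR_continuous (hu : ContDiff ℝ 2 u) (m : ℤ) : Continuous (cR u m) := by
  unfold cR
  apply intervalIntegral.continuous_parametric_intervalIntegral_of_continuous'
  have := hu.continuous
  have := ev_continuous
  have := chr_continuous m
  simp only [Function.uncurry_def]
  fun_prop

lemma dR_continuous (hu : ContDiff ℝ 2 u) (m : ℤ) : Continuous (dR u m) := by
  unfold dR
  apply intervalIntegral.continuous_parametric_intervalIntegral_of_continuous'
  have := (du_contDiff hu).continuous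
  have := ev_continuous
  have := chr_continuous m
  simp only [Function.uncurry_def]
  fun_prop

lemma cR_deriv (hu : ContDiff ℝ 2 u) (m : ℤ) (s : ℝ) :
    HasDerivAt (fun s => cR u m (Real.exp s)) (dR u m (Real.exp s)) s := by
  have h0 := hu.continuous
  have h1 := (du_contDiff hu).continuous
  have h2 := ev_continuous
  have h3 := chr_continuous m
  exact hasDerivAt_param (F := fun s θ => u (Real.exp s • ev θ) * chr m θ)
    (F' := fun s θ => fderiv ℝ u (Real.exp s • ev θ) (Real.exp s • ev θ) * chr m θ)
    0 (2 * Real.pi) (fun s => by fun_prop) (by simp only [Function.uncurry_def]; fun_prop)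
    (fun s θ => (U_s hu s θ).mul_const _) s

lemma dR_deriv (hu : ContDiff ℝ 2 u) (m : ℤ) (κ : ℝ) (s : ℝ) (hs : s ≤ 0)
    (hpde : ∀ x ∈ Metric.ball (0 : EuclideanSpace ℝ (Fin 2)) 1,
      lap u x + (κ : ℂ) ^ 2 * u x = 0) :
    HasDerivAt (fun s => dR u m (Real.exp s))
      ((((m : ℝ) ^ 2 - (κ * Real.exp s) ^ 2 : ℝ) : ℂ) * cR u m (Real.exp s)) s := by
  have h0 := hu.continuous
  have h1 := (du_contDiff hu).continuous
  have h1' := d2u_cont hu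
  have h2 := ev_continuous
  have h2' := ew_continuous
  have h3 := chr_continuous m
  have hpde' : ∀ θ, lap u (Real.exp s • ev θ) = - ((κ : ℂ) ^ 2 * u (Real.exp s • ev θ)) := by
    intro θ
    have hcl : IsClosed {x | lap u x + (κ : ℂ) ^ 2 * u x = 0} :=
      isClosed_eq ((lap_continuous hu).add (continuous_const.mul h0)) continuous_const
    have hsub : Metric.closedBall (0 : EuclideanSpace ℝ (Fin 2)) 1 ⊆
        {x | lap u x + (κ : ℂ) ^ 2 * u x = 0} := by
      rw [← closure_ball _ one_ne_zero]
      exact closure_minimal hpde hcl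
    have hm : Real.exp s • ev θ ∈ Metric.closedBall (0 : EuclideanSpace ℝ (Fin 2)) 1 := by
      rw [mem_closedBall_zero_iff, norm_smul, ev_norm, mul_one, Real.norm_eq_abs, Real.abs_exp]
      exact Real.exp_le_one_iff.2 hs
    have h4 : lap u (Real.exp s • ev θ) + (κ : ℂ) ^ 2 * u (Real.exp s • ev θ) = 0 := hsub hm
    linear_combination h4
  have key := hasDerivAt_param
    (F := fun s θ => fderiv ℝ u (Real.exp s • ev θ) (Real.exp s • ev θ) * chr m θ)
    (F' := fun s θ => (fderiv ℝ (fderiv ℝ u) (Real.exp s • ev θ) (Real.exp s • ev θ)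
      (Real.exp s • ev θ) + fderiv ℝ u (Real.exp s • ev θ) (Real.exp s • ev θ)) * chr m θ)
    0 (2 * Real.pi) (fun s => by fun_prop) (by simp only [Function.uncurry_def]; fun_prop)
    (fun s θ => (U_ss hu s θ).mul_const _) s
  refine key.congr_deriv ?_
  have i1 := ibp m (fun θ => U_θ hu s θ) (by fun_prop)
    (by have e := ev_periodic 0; rw [zero_add] at e; rw [e])
  have i2 := ibp m (fun θ => U_θθ hu s θ) (by fun_prop)
    (by
      have e := ev_periodic 0
      have e' := ew_periodic 0
      rw [zero_add] at e e'; rw [e, e'])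
  rw [i1] at i2
  have hpt : ∀ θ, (fderiv ℝ (fderiv ℝ u) (Real.exp s • ev θ) (Real.exp s • ev θ)
      (Real.exp s • ev θ) + fderiv ℝ u (Real.exp s • ev θ) (Real.exp s • ev θ)) * chr m θ
      = - ((κ : ℂ) ^ 2 * (Real.exp s : ℂ) ^ 2) * (u (Real.exp s • ev θ) * chr m θ)
       - (fderiv ℝ (fderiv ℝ u) (Real.exp s • ev θ) (Real.exp s • ew θ) (Real.exp s • ew θ)
      - fderiv ℝ u (Real.exp s • ev θ) (Real.exp s • ev θ)) * chr m θ := by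
    intro θ
    have := d2_polar hu (Real.exp s • ev θ) s θ
    rw [hpde' θ] at this
    linear_combination chr m θ * this
  simp_rw [hpt]
  rw [intervalIntegral.integral_sub (Continuous.intervalIntegrable (by fun_prop) _ _)
    (Continuous.intervalIntegrable (by fun_prop) _ _), i2, intervalIntegral.integral_const_mul]
  unfold cR
  push_cast
  linear_combination (-(m : ℂ) ^ 2 * ∫ θ in (0 : ℝ)..(2 * Real.pi),
    u (Real.exp s • ev θ) * chr m θ) * Complex.I_sq

end fwd

lemma chr_fourier_zero (f : ℝ → ℂ) (hf : Continuous f) (hp : Function.Periodic f (2 * Real.pi))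
    (h : ∀ m : ℤ, ∫ θ in (0 : ℝ)..(2 * Real.pi), f θ * chr m θ = 0) (θ : ℝ) : f θ = 0 := by
  have : Fact (0 < 2 * Real.pi) := ⟨Real.two_pi_pos⟩
  have hc : Continuous (hp.lift : AddCircle (2 * Real.pi) → ℂ) := by
    rw [(QuotientAddGroup.isQuotientMap_mk (N := AddSubgroup.zmultiples (2 * Real.pi))).continuous_iff]
    exact hf
  let g : C(AddCircle (2 * Real.pi), ℂ) := ⟨hp.lift, hc⟩
  have hg : ∀ x : ℝ, g (x : AddCircle (2 * Real.pi)) = f x := fun x => hp.lift_coe x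
  have h0 : fourierCoeff g = 0 := by
    ext m
    rw [fourierCoeff_eq_intervalIntegral _ _ 0]
    have : ∀ x : ℝ, (fourier (-m) (x : AddCircle (2 * Real.pi)) : ℂ) • g x = f x * chr m x := by
      intro x
      rw [hg, fourier_coe_apply, smul_eq_mul, mul_comm]
      unfold chr
      congr 2
      have : (Real.pi : ℂ) ≠ 0 := by exact_mod_cast Real.pi_ne_zero
      push_cast
      field_simp
    simp_rw [this]
    rw [zero_add, h m]
    simp
  have hs : Summable (fourierCoeff g) := by rw [h0]; exact summable_zero
  have := has_pointwise_sum_fourier_series_of_summable hs (θ : AddCircle (2 * Real.pi))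
  rw [h0, hg] at this
  simp only [Pi.zero_apply, zero_smul] at this
  exact this.unique hasSum_zero

lemma ode_unique {c d : ℝ → ℂ} {q : ℝ → ℝ} (B : ℝ) (hq : ∀ s ≤ 0, |q s| ≤ B)
    (hc : ∀ s, HasDerivAt c (d s) s) (hdc : Continuous d)
    (hd : ∀ s ≤ 0, HasDerivAt d ((q s : ℂ) * c s) s)
    (hc0 : c 0 = 0) (hd0 : d 0 = 0) (s : ℝ) (hs : s ≤ 0) : c s = 0 := by
  have hcc : Continuous c := continuous_iff_continuousAt.2 fun t => (hc t).continuousAt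
  have key := ODE_solution_unique_of_mem_Icc_left (E := ℂ × ℂ) (a := s) (b := 0)
    (v := fun t p => (p.2, (q t : ℂ) * p.1)) (s := fun _ => Set.univ)
    (K := Real.toNNReal (max 1 B))
    (f := fun t => (c t, d t)) (g := fun _ => (0, 0))
    (fun t ht => by
      apply LipschitzOnWith.of_dist_le_mul
      intro x _ y _
      rw [Real.coe_toNNReal _ (le_max_of_le_left zero_le_one), Prod.dist_eq, Prod.dist_eq]
      have h1 : dist ((q t : ℂ) * x.1) ((q t : ℂ) * y.1) ≤ B * dist x.1 y.1 := by
        rw [dist_eq_norm, dist_eq_norm, ← mul_sub, norm_mul, Complex.norm_real, Real.norm_eq_abs]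
        exact mul_le_mul_of_nonneg_right (hq t ht.2) (norm_nonneg _)
      have h2 : B * dist x.1 y.1 ≤ max 1 B * max (dist x.1 y.1) (dist x.2 y.2) :=
        mul_le_mul (le_max_right _ _) (le_max_left _ _) dist_nonneg
          (le_max_of_le_left zero_le_one)
      have h3 : 1 * dist x.2 y.2 ≤ max 1 B * max (dist x.1 y.1) (dist x.2 y.2) :=
        mul_le_mul (le_max_left _ _) (le_max_right _ _) dist_nonneg
          (le_max_of_le_left zero_le_one)
      refine max_le ?_ (h1.trans h2)
      rw [one_mul] at h3
      exact h3)
    (hcc.prodMk hdc).continuousOn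
    (fun t ht => ((hc t).prodMk (hd t ht.2)).hasDerivWithinAt)
    (fun _ _ => Set.mem_univ _) continuousOn_const
    (fun t _ => by
      have := (hasDerivAt_const t ((0 : ℂ), (0 : ℂ))).hasDerivWithinAt (s := Set.Iic t)
      refine this.congr_deriv ?_
      simp only [mul_zero]
      rfl)
    (fun _ _ => Set.mem_univ _) (by simp [hc0, hd0])
  have := key (Set.left_mem_Icc.2 hs)
  exact (Prod.mk.inj this).1

section fwd2
variable {u : EuclideanSpace ℝ (Fin 2) → ℂ}

lemma tendsto_exp_bot : Tendsto Real.exp atBot (𝓝 0) := Real.tendsto_exp_atBot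

lemma wronskian (hu : ContDiff ℝ 2 u) (m : ℤ) (κ : ℝ)
    (hpde : ∀ x ∈ Metric.ball (0 : EuclideanSpace ℝ (Fin 2)) 1,
      lap u x + (κ : ℂ) ^ 2 * u x = 0) :
    dR u m 1 * (besselJ m.natAbs κ : ℂ) = cR u m 1 * (bD m.natAbs κ : ℂ) := by
  set M := m.natAbs with hM
  have hMm : ((M : ℝ)) ^ 2 = (m : ℝ) ^ 2 := by
    rw [hM, Nat.cast_natAbs, Int.cast_abs, sq_abs]
  let WW : ℝ → ℂ := fun r => dR u m r * (besselJ M (κ * r) : ℂ) - cR u m r * (bD M (κ * r) : ℂ)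
  have hWc : Continuous WW := by
    have h1 := dR_continuous hu m
    have h2 := cR_continuous hu m
    have h3 := besselJ_continuous M
    have h4 := bD_continuous M
    show Continuous fun r => dR u m r * (besselJ M (κ * r) : ℂ) - cR u m r * (bD M (κ * r) : ℂ)
    fun_prop
  have hW0 : WW 0 = 0 := by
    have h1 : dR u m 0 = 0 := by simp [dR]
    have h2 : bD M (κ * 0) = 0 := by rw [← bD_eq]; simp
    show dR u m 0 * (besselJ M (κ * 0) : ℂ) - cR u m 0 * (bD M (κ * 0) : ℂ) = 0
    rw [h1, h2]; simp
  have hd : ∀ s ≤ 0, HasDerivAt (fun s => WW (Real.exp s)) 0 s := by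
    intro s hs
    have a1 := cR_deriv hu m s
    have a2 := dR_deriv hu m κ s hs hpde
    have a3 := (besselJ_exp M κ s).ofReal_comp
    have a4 := (bD_exp M κ s).ofReal_comp
    refine ((a2.mul a3).sub (a1.mul a4)).congr_deriv ?_
    rw [hMm]
    push_cast
    ring
  have hconst : ∀ s ≤ 0, WW (Real.exp s) = WW 1 := by
    intro s hs
    have := constant_of_has_deriv_right_zero (f := fun s => WW (Real.exp s)) (a := s) (b := 0)
      (hWc.comp Real.continuous_exp).continuousOn
      (fun t ht => (hd t ht.2.le).hasDerivWithinAt) 0 (Set.right_mem_Icc.2 hs)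
    simpa using this.symm
  have t1 : Tendsto (fun s => WW (Real.exp s)) atBot (𝓝 0) := by
    rw [← hW0]
    exact (hWc.tendsto 0).comp tendsto_exp_bot
  have t2 : Tendsto (fun s => WW (Real.exp s)) atBot (𝓝 (WW 1)) :=
    tendsto_const_nhds.congr' ((eventually_le_atBot 0).mono fun s hs => (hconst s hs).symm)
  have h := tendsto_nhds_unique t2 t1
  have h' : dR u m 1 * (besselJ M (κ * 1) : ℂ) - cR u m 1 * (bD M (κ * 1) : ℂ) = 0 := h
  rw [mul_one] at h'
  exact sub_eq_zero.1 h'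

lemma vanish (hu : ContDiff ℝ 2 u) (κ : ℝ)
    (hpde : ∀ x ∈ Metric.ball (0 : EuclideanSpace ℝ (Fin 2)) 1,
      lap u x + (κ : ℂ) ^ 2 * u x = 0)
    (hc : ∀ m, cR u m 1 = 0) (hd : ∀ m, dR u m 1 = 0) :
    ∀ x ∈ Metric.ball (0 : EuclideanSpace ℝ (Fin 2)) 1, u x = 0 := by
  have h1 : ∀ m : ℤ, ∀ s ≤ 0, cR u m (Real.exp s) = 0 := by
    intro m s hs
    refine ode_unique (c := fun s => cR u m (Real.exp s)) (d := fun s => dR u m (Real.exp s))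
      (q := fun s => (m : ℝ) ^ 2 - (κ * Real.exp s) ^ 2) ((m : ℝ) ^ 2 + κ ^ 2) ?_
      (cR_deriv hu m) ((dR_continuous hu m).comp Real.continuous_exp)
      (fun t ht => dR_deriv hu m κ t ht hpde) (by simp [hc]) (by simp [hd]) s hs
    intro t ht
    have e1 : Real.exp t ≤ 1 := Real.exp_le_one_iff.2 ht
    have e0 := Real.exp_pos t
    have e2 : Real.exp t ^ 2 ≤ 1 := by nlinarith
    have e3 : (κ * Real.exp t) ^ 2 ≤ κ ^ 2 := by
      rw [mul_pow]
      nlinarith [sq_nonneg κ]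
    rw [abs_le]
    constructor <;> nlinarith [sq_nonneg (m : ℝ), sq_nonneg (κ * Real.exp t), sq_nonneg κ]
  have h2 : ∀ s ≤ 0, ∀ θ, u (Real.exp s • ev θ) = 0 := by
    intro s hs θ
    refine chr_fourier_zero (fun θ => u (Real.exp s • ev θ)) ?_ ?_ (fun m => h1 m s hs) θ
    · have hh0 := hu.continuous
      have hh1 := ev_continuous
      fun_prop
    · intro θ
      simp only [ev_periodic]
  intro x hx
  by_cases hx0 : x = 0
  · subst hx0
    have t1 : Tendsto (fun s => u (Real.exp s • ev 0)) atBot (𝓝 (u 0)) := by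
      have : Tendsto (fun s => Real.exp s • ev 0) atBot (𝓝 0) := by
        simpa using tendsto_exp_bot.smul_const (ev 0)
      exact (hu.continuous.tendsto 0).comp this
    have t2 : Tendsto (fun s => u (Real.exp s • ev 0)) atBot (𝓝 0) :=
      tendsto_const_nhds.congr' ((eventually_le_atBot 0).mono fun s hs => (h2 s hs 0).symm)
    exact tendsto_nhds_unique t1 t2
  · obtain ⟨s, θ, rfl, hs⟩ := exists_polar x hx0
    refine h2 s ?_ θ
    rw [← Real.exp_le_one_iff, hs]
    exact (mem_ball_zero_iff.1 hx).le

end fwd2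

lemma forward (κ k η : ℝ) (w v : EuclideanSpace ℝ (Fin 2) → ℂ) (hw : ContDiff ℝ 2 w)
    (hv : ContDiff ℝ 2 v)
    (hpw : ∀ x ∈ Metric.ball (0 : EuclideanSpace ℝ (Fin 2)) 1, lap w x + (κ : ℂ) ^ 2 * w x = 0)
    (hpv : ∀ x ∈ Metric.ball (0 : EuclideanSpace ℝ (Fin 2)) 1, lap v x + (k : ℂ) ^ 2 * v x = 0)
    (hb : ∀ x ∈ Metric.sphere (0 : EuclideanSpace ℝ (Fin 2)) 1, w x = v x)
    (hb' : ∀ x ∈ Metric.sphere (0 : EuclideanSpace ℝ (Fin 2)) 1,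
        nder id w x - nder id v x = (η : ℂ) * v x)
    (hdet : ∀ m : ℕ, - bD m k * besselJ m κ + besselJ m k * (bD m κ - η * besselJ m κ) ≠ 0) :
    ∀ x ∈ Metric.ball (0 : EuclideanSpace ℝ (Fin 2)) 1, w x = 0 ∧ v x = 0 := by
  have hsph : ∀ θ, (1 : ℝ) • ev θ ∈ Metric.sphere (0 : EuclideanSpace ℝ (Fin 2)) 1 := by
    intro θ
    rw [mem_sphere_zero_iff_norm, one_smul, ev_norm]
  have e1 : ∀ m, cR w m 1 = cR v m 1 := by
    intro m
    unfold cR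
    congr 1
    ext θ
    rw [hb _ (hsph θ)]
  have e2 : ∀ m, dR w m 1 = dR v m 1 + η * cR v m 1 := by
    intro m
    have h1 := (du_contDiff hv).continuous
    have h2 := ev_continuous
    have h3 := chr_continuous m
    have h4 := hv.continuous
    unfold cR dR
    rw [← intervalIntegral.integral_const_mul, ← intervalIntegral.integral_add
      (Continuous.intervalIntegrable (by fun_prop) _ _)
      (Continuous.intervalIntegrable (by fun_prop) _ _)]
    congr 1
    ext θ
    have := hb' _ (hsph θ)
    rw [nder_eq, nder_eq] at this
    linear_combination chr m θ * this
  have e3 : ∀ m, cR w m 1 = 0 ∧ cR v m 1 = 0 ∧ dR w m 1 = 0 ∧ dR v m 1 = 0 := by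
    intro m
    have w1 := wronskian hw m κ hpw
    have w2 := wronskian hv m k hpv
    have hD : (- bD m.natAbs k * besselJ m.natAbs κ + besselJ m.natAbs k * (bD m.natAbs κ
      - η * besselJ m.natAbs κ) : ℂ) ≠ 0 := by exact_mod_cast hdet m.natAbs
    rw [e1, e2] at w1
    rw [e1, e2]
    have hA : cR v m 1 = 0 := by
      have : cR v m 1 * (- bD m.natAbs k * besselJ m.natAbs κ + besselJ m.natAbs k * (bD m.natAbs κ
        - η * besselJ m.natAbs κ) : ℂ) = 0 := by
        linear_combination (-besselJ m.natAbs k : ℂ) * w1 + (besselJ m.natAbs κ : ℂ) * w2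
      exact (mul_eq_zero.1 this).resolve_right hD
    have hB : dR v m 1 = 0 := by
      by_contra hne
      rw [hA] at w1 w2
      simp only [mul_zero, zero_mul, add_zero] at w1 w2
      have z1 := (mul_eq_zero.1 w1).resolve_left hne
      have z2 := (mul_eq_zero.1 w2).resolve_left hne
      apply hD
      rw [z1, z2]; ring
    simp [hA, hB]
  have r1 := vanish hw κ hpw (fun m => (e3 m).1) (fun m => (e3 m).2.2.1)
  have r2 := vanish hv k hpv (fun m => (e3 m).2.1) (fun m => (e3 m).2.2.2)
  exact fun x hx => ⟨r1 x hx, r2 x hx⟩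

/-- Complex coordinate on the plane. -/
def zL : EuclideanSpace ℝ (Fin 2) →L[ℝ] ℂ :=
  Complex.ofRealCLM.comp (EuclideanSpace.proj 0)
    + Complex.I • Complex.ofRealCLM.comp (EuclideanSpace.proj 1)

lemma zL_apply (x : EuclideanSpace ℝ (Fin 2)) : zL x = (x 0 : ℂ) + Complex.I * (x 1 : ℂ) := by
  simp [zL]

/-- Building block `z^p G_q(l |x|^2)`. -/
def Phi (l : ℝ) (p q : ℕ) (x : EuclideanSpace ℝ (Fin 2)) : ℂ :=
  zL x ^ p * (bG q (l * (x 0 ^ 2 + x 1 ^ 2)) : ℂ)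

lemma coord_hasFDerivAt (i : Fin 2) (x : EuclideanSpace ℝ (Fin 2)) :
    HasFDerivAt (fun x : EuclideanSpace ℝ (Fin 2) => x i) (EuclideanSpace.proj (𝕜 := ℝ) i) x :=
  (EuclideanSpace.proj (𝕜 := ℝ) i).hasFDerivAt

lemma Phi_hasFDerivAt (l : ℝ) (p q : ℕ) (x : EuclideanSpace ℝ (Fin 2)) :
    ∃ L : EuclideanSpace ℝ (Fin 2) →L[ℝ] ℂ, HasFDerivAt (Phi l p q) L x ∧
      ∀ h, L h = p * zL h * Phi l (p - 1) q x
        - 2 * l * (x 0 * h 0 + x 1 * h 1 : ℝ) * Phi l p (q + 1) x := by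
  have h1 : HasFDerivAt (fun x => zL x ^ p) _ x := (zL.hasFDerivAt (x := x)).pow p
  have h2 := (((coord_hasFDerivAt 0 x).pow 2).add ((coord_hasFDerivAt 1 x).pow 2)).const_mul l
  have h3 := (bG_hasDerivAt q (l * (x 0 ^ 2 + x 1 ^ 2))).comp_hasFDerivAt x h2
  have h4 := Complex.ofRealCLM.hasFDerivAt.comp x h3
  refine ⟨_, h1.mul h4, ?_⟩
  intro h
  unfold Phi
  simp
  ring

lemma Phi_contDiff (l : ℝ) (p q : ℕ) : ContDiff ℝ 2 (Phi l p q) := by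
  unfold Phi
  have h0 : ContDiff ℝ 2 (fun x : EuclideanSpace ℝ (Fin 2) => l * (x 0 ^ 2 + x 1 ^ 2)) := by
    fun_prop
  have h1 := (bG_contDiff_nat 2 q).comp h0
  exact (zL.contDiff.pow p).mul (Complex.ofRealCLM.contDiff.comp h1)

lemma Phi_fderiv (l : ℝ) (p q : ℕ) (x h : EuclideanSpace ℝ (Fin 2)) :
    fderiv ℝ (Phi l p q) x h = p * zL h * Phi l (p - 1) q x
        - 2 * l * (x 0 * h 0 + x 1 * h 1 : ℝ) * Phi l p (q + 1) x := by
  obtain ⟨L, hL, e⟩ := Phi_hasFDerivAt l p q x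
  rw [hL.fderiv, e]

lemma Phi_pd2 (l : ℝ) (m : ℕ) (i : Fin 2) (x : EuclideanSpace ℝ (Fin 2)) :
    fderiv ℝ (fun y => fderiv ℝ (Phi l m m) y (EuclideanSpace.single i 1)) x
      (EuclideanSpace.single i 1) =
    m * zL (EuclideanSpace.single i 1) * (((m - 1 : ℕ) : ℂ) * zL (EuclideanSpace.single i 1)
      * Phi l (m - 1 - 1) m x - 2 * l * x i * Phi l (m - 1) (m + 1) x)
    - 2 * l * (Phi l m (m + 1) x + x i * (m * zL (EuclideanSpace.single i 1) *
      Phi l (m - 1) (m + 1) x - 2 * l * x i * Phi l m (m + 2) x)) := by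
  have hfun : (fun y => fderiv ℝ (Phi l m m) y (EuclideanSpace.single i 1)) =
      fun y => m * zL (EuclideanSpace.single i 1) * Phi l (m - 1) m y
        - 2 * l * ((y i : ℝ) * Phi l m (m + 1) y) := by
    ext y
    rw [Phi_fderiv]
    fin_cases i <;> simp <;> ring
  rw [hfun]
  obtain ⟨L1, hL1, e1⟩ := Phi_hasFDerivAt l (m - 1) m x
  obtain ⟨L2, hL2, e2⟩ := Phi_hasFDerivAt l m (m + 1) x
  have hx := Complex.ofRealCLM.hasFDerivAt.comp x (coord_hasFDerivAt i x)
  have key := (hL1.const_mul ((m : ℂ) * zL (EuclideanSpace.single i 1))).sub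
    ((hx.mul hL2).const_mul (2 * l : ℂ))
  have kk := key.fderiv
  refine (congrArg (fun L : EuclideanSpace ℝ (Fin 2) →L[ℝ] ℂ =>
    L (EuclideanSpace.single i 1)) kk).trans ?_
  fin_cases i <;> simp [e1, e2] <;> ring

lemma Phi_lap (l : ℝ) (m : ℕ) (x : EuclideanSpace ℝ (Fin 2)) :
    lap (Phi l m m) x = - (4 * l * Phi l m m x) := by
  unfold lap
  simp only [Phi_pd2, Fin.sum_univ_two]
  have z0 : zL (EuclideanSpace.single 0 1) = 1 := by simp [zL_apply]
  have z1 : zL (EuclideanSpace.single 1 1) = Complex.I := by simp [zL_apply]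
  rw [z0, z1]
  have hm : (m : ℂ) * ((x 0 : ℂ) + Complex.I * (x 1 : ℂ)) * Phi l (m - 1) (m + 1) x
      = m * Phi l m (m + 1) x := by
    rw [← zL_apply]
    unfold Phi
    cases m with
    | zero => simp
    | succ k => simp only [Nat.add_sub_cancel, pow_succ]; ring
  have ode : (((l * (x 0 ^ 2 + x 1 ^ 2)) * bG (m + 2) (l * (x 0 ^ 2 + x 1 ^ 2))
      - ((m : ℝ) + 1) * bG (m + 1) (l * (x 0 ^ 2 + x 1 ^ 2)) + bG m (l * (x 0 ^ 2 + x 1 ^ 2)) : ℝ)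
      : ℂ) = 0 := by
    rw [bG_ode]; simp
  have ode2 : (l * (x 0 ^ 2 + x 1 ^ 2) : ℂ) * Phi l m (m + 2) x - (m + 1) * Phi l m (m + 1) x
      + Phi l m m x = 0 := by
    unfold Phi
    push_cast at ode
    linear_combination zL x ^ m * ode
  linear_combination (-4 * l : ℂ) * hm + 4 * l * ode2
    + (m * ((m - 1 : ℕ) : ℂ) * Phi l (m - 1 - 1) m x) * Complex.I_sq

lemma Phi_euler (l : ℝ) (m : ℕ) (x : EuclideanSpace ℝ (Fin 2)) :
    fderiv ℝ (Phi l m m) x x = m * Phi l m m x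
      - 2 * l * (x 0 ^ 2 + x 1 ^ 2) * Phi l m (m + 1) x := by
  rw [Phi_fderiv]
  have hm : (m : ℂ) * zL x * Phi l (m - 1) m x = m * Phi l m m x := by
    unfold Phi
    cases m with
    | zero => simp
    | succ k => simp only [Nat.add_sub_cancel, pow_succ]; ring
  push_cast
  linear_combination hm

/-- Separated solution `a J_m(κ r) e^{imθ}`. -/
def uB (a κ : ℝ) (m : ℕ) (x : EuclideanSpace ℝ (Fin 2)) : ℂ :=
  ((a * (κ / 2) ^ m : ℝ) : ℂ) * Phi (κ ^ 2 / 4) m m x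

lemma uB_contDiff (a κ : ℝ) (m : ℕ) : ContDiff ℝ 2 (uB a κ m) :=
  contDiff_const.mul (Phi_contDiff _ _ _)

lemma uB_fderiv (a κ : ℝ) (m : ℕ) (x h : EuclideanSpace ℝ (Fin 2)) :
    fderiv ℝ (uB a κ m) x h
      = ((a * (κ / 2) ^ m : ℝ) : ℂ) * fderiv ℝ (Phi (κ ^ 2 / 4) m m) x h := by
  have := (((Phi_contDiff (κ ^ 2 / 4) m m).differentiable (by norm_num) x).hasFDerivAt.const_mul
    ((a * (κ / 2) ^ m : ℝ) : ℂ)).fderiv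
  have e : fderiv ℝ (uB a κ m) x = _ := this
  rw [e]; simp

lemma uB_lap (a κ : ℝ) (m : ℕ) (x : EuclideanSpace ℝ (Fin 2)) :
    lap (uB a κ m) x + (κ : ℂ) ^ 2 * uB a κ m x = 0 := by
  have : lap (uB a κ m) x = ((a * (κ / 2) ^ m : ℝ) : ℂ) * lap (Phi (κ ^ 2 / 4) m m) x := by
    unfold lap
    rw [Finset.mul_sum]
    refine Finset.sum_congr rfl fun i _ => ?_
    simp_rw [uB_fderiv]
    have hd : DifferentiableAt ℝ (fun y => fderiv ℝ (Phi (κ ^ 2 / 4) m m) y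
        (EuclideanSpace.single i 1)) x :=
      (du_diff (Phi_contDiff (κ ^ 2 / 4) m m) x).clm_apply (differentiableAt_const _)
    rw [fderiv_const_mul hd]
    simp
  rw [this, Phi_lap]
  unfold uB
  push_cast
  ring

lemma sphere_rho {x : EuclideanSpace ℝ (Fin 2)}
    (hx : x ∈ Metric.sphere (0 : EuclideanSpace ℝ (Fin 2)) 1) : x 0 ^ 2 + x 1 ^ 2 = 1 := by
  have h := mem_sphere_zero_iff_norm.1 hx
  have h2 := EuclideanSpace.norm_sq_eq x
  rw [h, Fin.sum_univ_two] at h2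
  simp only [Real.norm_eq_abs, sq_abs] at h2
  linarith

lemma uB_sphere (a κ : ℝ) (m : ℕ) {x : EuclideanSpace ℝ (Fin 2)}
    (hx : x ∈ Metric.sphere (0 : EuclideanSpace ℝ (Fin 2)) 1) :
    uB a κ m x = zL x ^ m * ((a * besselJ m κ : ℝ) : ℂ) := by
  unfold uB Phi
  rw [sphere_rho hx, mul_one, besselJ_eq]
  push_cast
  ring

lemma uB_nder (a κ : ℝ) (m : ℕ) {x : EuclideanSpace ℝ (Fin 2)}
    (hx : x ∈ Metric.sphere (0 : EuclideanSpace ℝ (Fin 2)) 1) :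
    nder id (uB a κ m) x = zL x ^ m * ((a * bD m κ : ℝ) : ℂ) := by
  have h : ((x 0 : ℂ) ^ 2 + (x 1 : ℂ) ^ 2) = 1 := by
    have h0 := congrArg (fun t : ℝ => (t : ℂ)) (sphere_rho hx)
    push_cast at h0
    exact h0
  rw [nder_eq, uB_fderiv, Phi_euler, h]
  unfold Phi bD
  rw [sphere_rho hx, mul_one]
  push_cast
  ring

lemma uB_nontrivial (a κ : ℝ) (m : ℕ) (ha : a ≠ 0) (hκ : 0 < κ) :
    ∃ x ∈ Metric.ball (0 : EuclideanSpace ℝ (Fin 2)) 1, uB a κ m x ≠ 0 := by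
  have hc : Continuous fun t : ℝ => bG m (κ ^ 2 / 4 * t ^ 2) :=
    (bG_continuous m).comp (by fun_prop)
  have h0 : ∀ᶠ t in 𝓝[>] (0 : ℝ), bG m (κ ^ 2 / 4 * t ^ 2) ≠ 0 := by
    refine nhdsWithin_le_nhds (hc.continuousAt.eventually_ne ?_)
    simpa using bG_zero m
  have h1 : ∀ᶠ t in 𝓝[>] (0 : ℝ), t ∈ Set.Ioo (0 : ℝ) 1 := Ioo_mem_nhdsGT one_pos
  obtain ⟨t, ht, ht0, ht1⟩ := (h0.and h1).exists
  refine ⟨EuclideanSpace.single 0 t, ?_, ?_⟩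
  · rw [mem_ball_zero_iff, EuclideanSpace.norm_single, Real.norm_eq_abs, abs_of_pos ht0]
    exact ht1
  · unfold uB Phi
    rw [zL_apply]
    have hκ' : κ ≠ 0 := hκ.ne'
    simp [ha, hκ', ht0.ne', ht]

lemma backward (κ k η : ℝ) (m : ℕ)
    (hdet : - bD m k * besselJ m κ + besselJ m k * (bD m κ - η * besselJ m κ) = 0) :
    ∃ a b : ℝ, ¬ (a = 0 ∧ b = 0) ∧ a * besselJ m κ = b * besselJ m k ∧
      a * bD m κ - b * bD m k = η * (b * besselJ m k) := by
  by_cases h1 : besselJ m κ = 0 ∧ besselJ m k = 0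
  · by_cases h2 : bD m κ = 0 ∧ bD m k = 0
    · exact ⟨1, 1, by simp, by rw [h1.1, h1.2], by rw [h2.1, h2.2, h1.2]; ring⟩
    · refine ⟨bD m k, bD m κ, fun h => h2 ⟨h.2, h.1⟩, by rw [h1.1, h1.2]; ring, ?_⟩
      rw [h1.2]; ring
  · exact ⟨besselJ m k, besselJ m κ, fun h => h1 ⟨h.2, h.1⟩, by ring, by linear_combination hdet⟩

/-- for the unit disk with constant refractive index `n > 0` and
conductivity `η > 0`, `k > 0` is a transmission eigenvalue with conductive boundary
condition (there is a nontrivial pair `(w,v)` with `Δw + k²nw = 0`, `Δv + k²v = 0` in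
the disk, `w = v` and `∂_r w − ∂_r v = ηv` on the unit circle) iff for some `m ≥ 0`
the `2×2` determinant vanishes:
`−k J_m'(k) J_m(k√n) + J_m(k)(k√n J_m'(k√n) − η J_m(k√n)) = 0`. -/
theorem unit_disk_determinant_condition (n η k : ℝ) (hn : 0 < n) (hη : 0 < η)
    (hk : 0 < k) :
    (∃ w v : EuclideanSpace ℝ (Fin 2) → ℂ, ContDiff ℝ 2 w ∧ ContDiff ℝ 2 v ∧
      ¬ (∀ x ∈ Metric.ball (0 : EuclideanSpace ℝ (Fin 2)) 1, w x = 0 ∧ v x = 0) ∧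
      (∀ x ∈ Metric.ball (0 : EuclideanSpace ℝ (Fin 2)) 1,
        lap w x + (k : ℂ) ^ 2 * (n : ℂ) * w x = 0) ∧
      (∀ x ∈ Metric.ball (0 : EuclideanSpace ℝ (Fin 2)) 1,
        lap v x + (k : ℂ) ^ 2 * v x = 0) ∧
      (∀ x ∈ Metric.sphere (0 : EuclideanSpace ℝ (Fin 2)) 1, w x = v x) ∧
      (∀ x ∈ Metric.sphere (0 : EuclideanSpace ℝ (Fin 2)) 1,
        nder id w x - nder id v x = (η : ℂ) * v x)) ↔
    ∃ m : ℕ, -k * deriv (besselJ m) k * besselJ m (k * Real.sqrt n)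
      + besselJ m k * (k * Real.sqrt n * deriv (besselJ m) (k * Real.sqrt n)
        - η * besselJ m (k * Real.sqrt n)) = 0 := by
  set κ : ℝ := k * Real.sqrt n with hκdef
  have hκ : 0 < κ := mul_pos hk (Real.sqrt_pos.2 hn)
  have hκ2 : (κ : ℂ) ^ 2 = (k : ℂ) ^ 2 * (n : ℂ) := by
    have : κ ^ 2 = k ^ 2 * n := by rw [hκdef, mul_pow, Real.sq_sqrt hn.le]
    exact_mod_cast this
  have hdeteq : ∀ m : ℕ, -k * deriv (besselJ m) k * besselJ m κ
      + besselJ m k * (κ * deriv (besselJ m) κ - η * besselJ m κ)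
      = - bD m k * besselJ m κ + besselJ m k * (bD m κ - η * besselJ m κ) := by
    intro m
    rw [← bD_eq, ← bD_eq]; ring
  simp_rw [hdeteq]
  constructor
  · rintro ⟨w, v, hw, hv, hnt, hpw, hpv, hb, hb'⟩
    by_contra hno
    push Not at hno
    apply hnt
    refine forward κ k η w v hw hv ?_ hpv hb hb' hno
    intro x hx
    rw [hκ2]
    exact hpw x hx
  · rintro ⟨m, hm⟩
    obtain ⟨a, b, hab, e1, e2⟩ := backward κ k η m hm
    refine ⟨uB a κ m, uB b k m, uB_contDiff _ _ _, uB_contDiff _ _ _, ?_, ?_, ?_, ?_, ?_⟩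
    · intro hz
      apply hab
      constructor
      · by_contra ha
        obtain ⟨x, hx, hne⟩ := uB_nontrivial a κ m ha hκ
        exact hne (hz x hx).1
      · by_contra hb
        obtain ⟨x, hx, hne⟩ := uB_nontrivial b k m hb hk
        exact hne (hz x hx).2
    · intro x _
      rw [← hκ2]
      exact uB_lap a κ m x
    · intro x _
      exact uB_lap b k m x
    · intro x hx
      rw [uB_sphere _ _ _ hx, uB_sphere _ _ _ hx, e1]
    · intro x hx
      rw [uB_nder _ _ _ hx, uB_nder _ _ _ hx, uB_sphere _ _ _ hx]
      have : ((a * bD m κ : ℝ) : ℂ) - ((b * bD m k : ℝ) : ℂ)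
          = (η : ℂ) * ((b * besselJ m k : ℝ) : ℂ) := by exact_mod_cast e2
      linear_combination zL x ^ m * this

end
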